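/- arXiv:2508.19759 — 6 statements merged into one kernel-verified Lean document; each statement's English description precedes it below -/
import Mathlib

section
/- For any finite collection of gizmos G_i, any equivalence relation ∼ on the disjoint union of their location sets, and any subset L of the equivalence classes, the simulated set of traversal sequences on L (as defined in the simulation construction) is itself a gizmo on L. -/
/-- A traversal sequence on a location type `L`: a finite list of traversals `a → b`. -/
abbrev TravSeq (L : Type*) := List (L × L)

/-- A gizmo on `L`: a set of traversal sequences closed under inserting trivial
traversals and contracting consecutive composable traversals. -/
def IsGizmo {L : Type*} (G : Set (TravSeq L)) : Prop :=
  (∀ (X Y : TravSeq L) (a : L), X ++ Y ∈ G → X ++ [(a, a)] ++ Y ∈ G) ∧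
  (∀ (X Y : TravSeq L) (a b c : L), X ++ [(a, b), (b, c)] ++ Y ∈ G → X ++ [(a, c)] ++ Y ∈ G)

/-- A set of traversal sequences is prefix-closed if `X ++ Y ∈ G` implies `X ∈ G`. -/
def PrefixClosed {L : Type*} (G : Set (TravSeq L)) : Prop :=
  ∀ X Y : TravSeq L, X ++ Y ∈ G → X ∈ G

open scoped Classical in
/-- The subsequence of a traversal sequence on the disjoint union `Σ j, Loc j`
consisting of the traversals on the location set of the `i`-th gizmo,
viewed as a traversal sequence on `Loc i`. -/
noncomputable def projSeq {ι : Type*} {Loc : ι → Type*} (i : ι)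
    (Z : TravSeq (Σ j, Loc j)) : TravSeq (Loc i) :=
  Z.filterMap (fun p =>
    if h : p.1.1 = i ∧ p.2.1 = i then
      some (cast (congrArg Loc h.1) p.1.2, cast (congrArg Loc h.2) p.2.2)
    else none)

/-- `IsWalk s t Y` : the traversal sequence `Y` on the disjoint union of the constituent
location sets realizes the traversal `t` on the exposed locations: `Y` is nonempty, every
traversal of `Y` is a traversal on the location set of a single constituent gizmo, the
first entry starts in the class `t.1`, the last entry ends in the class `t.2`, and
consecutive entries are linked by the equivalence relation. -/
def IsWalk {ι : Type*} {Loc : ι → Type*} (s : Setoid (Σ j, Loc j))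
    {L : Set (Quotient s)} (t : ↥L × ↥L) (Y : TravSeq (Σ j, Loc j)) : Prop :=
  ∃ hY : Y ≠ [],
    (∀ p ∈ Y, p.1.1 = p.2.1) ∧
    Quotient.mk s (Y.head hY).1 = (t.1 : Quotient s) ∧
    Quotient.mk s (Y.getLast hY).2 = (t.2 : Quotient s) ∧
    List.Chain' (fun p q : (Σ j, Loc j) × (Σ j, Loc j) => s.r p.2 q.1) Y

/-- The simulated set of traversal sequences on the exposed classes `L`, for the
simulation given by the gizmos `G i`, the equivalence relation `s` on the disjoint union
of their location sets, and the subset `L` of equivalence classes: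
`X ∈ SimulatedGizmo G s L` iff there are walks `Y_j` through the network, one for each
traversal of `X`, such that for each `i` the concatenation (in order) of all the
traversals on the location set of `G i` lies in `G i`. -/
noncomputable def SimulatedGizmo {ι : Type*} {Loc : ι → Type*}
    (G : ∀ i, Set (TravSeq (Loc i))) (s : Setoid (Σ j, Loc j))
    (L : Set (Quotient s)) : Set (TravSeq ↥L) :=
  {X | ∃ Ys : List (TravSeq (Σ j, Loc j)),
        List.Forall₂ (IsWalk s) X Ys ∧
        ∀ i, projSeq i Ys.flatten ∈ G i}

/-- Splitting a `Forall₂` along an append on the left. -/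
theorem List.Forall₂.exists_of_append_left {α β : Type*} {R : α → β → Prop} {X Y : List α}
    {Z : List β} (h : List.Forall₂ R (X ++ Y) Z) :
    ∃ U V, Z = U ++ V ∧ List.Forall₂ R X U ∧ List.Forall₂ R Y V := by
  induction X generalizing Z with
  | nil => exact ⟨[], Z, rfl, .nil, h⟩
  | cons x X ih =>
    cases h with
    | cons hx h =>
      obtain ⟨U, V, rfl, hU, hV⟩ := ih h
      exact ⟨_ :: U, V, rfl, .cons hx hU, hV⟩

theorem projSeq_append {ι : Type*} {Loc : ι → Type*} (i : ι) (Y Z : TravSeq (Σ j, Loc j)) :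
    projSeq i (Y ++ Z) = projSeq i Y ++ projSeq i Z :=
  List.filterMap_append

/-- A trivial traversal projects to a trivial traversal or to nothing. -/
theorem projSeq_singleton_self {ι : Type*} {Loc : ι → Type*} (i : ι) (x : Σ j, Loc j) :
    projSeq i [(x, x)] = [] ∨ ∃ a, projSeq i [(x, x)] = [(a, a)] := by
  by_cases h : x.1 = i
  · right
    exact ⟨cast (congrArg Loc h) x.2, by simp [projSeq, h]⟩
  · left
    simp [projSeq, h]

/-- The one-step trivial walk at a representative of an exposed class. -/
theorem isWalk_singleton_self {ι : Type*} {Loc : ι → Type*} {s : Setoid (Σ j, Loc j)}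
    {L : Set (Quotient s)} {a : ↥L} {x : Σ j, Loc j} (hx : Quotient.mk s x = a) :
    IsWalk s (a, a) [(x, x)] :=
  ⟨by simp, by simp, hx, hx, List.isChain_singleton _⟩

/-- Walks realizing composable traversals concatenate. -/
theorem IsWalk.append {ι : Type*} {Loc : ι → Type*} {s : Setoid (Σ j, Loc j)}
    {L : Set (Quotient s)} {a b c : ↥L} {Y Z : TravSeq (Σ j, Loc j)}
    (hY : IsWalk s (a, b) Y) (hZ : IsWalk s (b, c) Z) : IsWalk s (a, c) (Y ++ Z) := by
  obtain ⟨hY, hYt, hYa, hYb, hYc⟩ := hY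
  obtain ⟨hZ, hZt, hZb, hZc, hZch⟩ := hZ
  refine ⟨by simp [hY], ?_, ?_, ?_, List.IsChain.append hYc hZch ?_⟩
  · intro p hp
    exact (List.mem_append.1 hp).elim (hYt p) (hZt p)
  · rwa [List.head_append_of_ne_nil hY]
  · rwa [List.getLast_append_of_ne_nil _ hZ]
  · intro p hp q hq
    rw [List.getLast?_eq_some_getLast hY, Option.mem_some_iff] at hp
    rw [List.head?_eq_some_head hZ, Option.mem_some_iff] at hq
    subst hp hq
    exact Quotient.exact (hYb.trans hZb.symm)

/-- For any finite collection of gizmos `G i` (with finite location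
sets), any equivalence relation on the disjoint union of their location sets, and any
subset `L` of the equivalence classes, the simulated set of traversal sequences on `L`
is itself a gizmo on `L`. -/
theorem simulated_isGizmo {ι : Type*} [Finite ι] {Loc : ι → Type*}
    [∀ i, Finite (Loc i)] (G : ∀ i, Set (TravSeq (Loc i))) (hG : ∀ i, IsGizmo (G i))
    (s : Setoid (Σ j, Loc j)) (L : Set (Quotient s)) :
    IsGizmo (SimulatedGizmo G s L) := by
  constructor
  · rintro X Y a ⟨Ys, hW, hYs⟩
    obtain ⟨U, V, rfl, hU, hV⟩ := hW.exists_of_append_left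
    obtain ⟨x, hx⟩ := Quotient.exists_rep (a : Quotient s)
    refine ⟨U ++ [[(x, x)]] ++ V,
      List.rel_append (List.rel_append hU (.cons (isWalk_singleton_self hx) .nil)) hV,
      fun i => ?_⟩
    have h := hYs i
    simp only [List.flatten_append, List.flatten_singleton, projSeq_append] at h ⊢
    rcases projSeq_singleton_self i x with h0 | ⟨y, h0⟩
    · rwa [h0, List.append_nil]
    · rw [h0]
      exact (hG i).1 _ _ y h
  · rintro X Y a b c ⟨Ys, hW, hYs⟩
    obtain ⟨_, V, rfl, hXP, hV⟩ := hW.exists_of_append_left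
    obtain ⟨U, _, rfl, hU, hP⟩ := hXP.exists_of_append_left
    obtain _ | ⟨hP, _ | ⟨hQ, _ | _⟩⟩ := hP
    rename_i P Q
    refine ⟨U ++ [P ++ Q] ++ V,
      List.rel_append (List.rel_append hU (.cons (hP.append hQ) .nil)) hV, fun i => ?_⟩
    simpa using hYs i
end

section
/- Let T be a finite multigraph without self-loops in which each vertex v carries an upward-closed vertex type U_v, with the edge-ends at v labeled bijectively by the locations of U_v, and let I and F be orientations of T that both satisfy every vertex. Then the following are equivalent: (1) I can be reconfigured to F by a sequence of synchronous GORP moves; (2) the half-edge orientations induced by I can be reconfigured to those induced by F by a sequence of asynchronous GORP moves; (3) the half-edge orientations induced by I can be reconfigured to those induced by F by a sequence of token GORP moves with the token absent in both the initial and final states. -/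
/-! ### Graph orientation reconfiguration (GORP)

A GORP instance is a finite multigraph without self-loops: vertices `V`, edges `E`, and
an incidence map `vend : E → Bool → V` giving the two endpoints of each edge (the two
half-edges of `e` are `(e, false)` and `(e, true)`, with `(e, b)` incident to
`vend e b`).  We take the locations of the vertex type at `v` to *be* the half-edges
incident to `v` (this realizes the bijection between edge-ends at `v` and locations), so
a vertex type is `U v : Set (Set (E × Bool))` whose members are sets of half-edges at
`v`.  An orientation is `o : E → Bool`, where `o e = b` means that `e` is directed
towards `vend e b`. -/

/-- The set of (locations of) incoming edges at `v` under the orientation `o`. -/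
def incomingAt {V E : Type*} (vend : E → Bool → V) (o : E → Bool) (v : V) :
    Set (E × Bool) := {x | vend x.1 x.2 = v ∧ o x.1 = x.2}

/-- The orientation `o` satisfies the instance: the set of locations of incoming edges
at each vertex `v` lies in `U v`. -/
def SatOrient {V E : Type*} (vend : E → Bool → V) (U : V → Set (Set (E × Bool)))
    (o : E → Bool) : Prop :=
  ∀ v, incomingAt vend o v ∈ U v

/-- Every member of a vertex type consists of half-edges at that vertex. -/
def TypesLocal {V E : Type*} (vend : E → Bool → V)
    (U : V → Set (Set (E × Bool))) : Prop :=
  ∀ v, ∀ S ∈ U v, ∀ x ∈ S, vend x.1 x.2 = v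

/-- All vertex types are upward-closed: enlarging a valid set of incoming half-edges at
`v` (within the half-edges at `v`) keeps it valid. -/
def UpwardClosed {V E : Type*} (vend : E → Bool → V)
    (U : V → Set (Set (E × Bool))) : Prop :=
  ∀ v, ∀ S ∈ U v, ∀ S' : Set (E × Bool),
    S ⊆ S' → (∀ x ∈ S', vend x.1 x.2 = v) → S' ∈ U v

/-- A synchronous GORP move: flip the orientation of a single edge, landing in an
orientation that satisfies the instance. -/
def SyncStep {V E : Type*} (vend : E → Bool → V) (U : V → Set (Set (E × Bool)))
    (o o' : E → Bool) : Prop :=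
  SatOrient vend U o' ∧ ∃ e, o' e ≠ o e ∧ ∀ e', e' ≠ e → o' e' = o e'

/-- The set of half-edges at `v` pointing vertexwards, for a half-edge orientation
`h : E × Bool → Bool` (`h x = true` meaning `x` points vertexwards). -/
def vertexwardsAt {V E : Type*} (vend : E → Bool → V) (h : E × Bool → Bool) (v : V) :
    Set (E × Bool) := {x | vend x.1 x.2 = v ∧ h x = true}

/-- A half-edge orientation is valid for asynchronous GORP: each vertex constraint
holds, and the two halves of an edge are never simultaneously vertexwards. -/
def AsyncValid {V E : Type*} (vend : E → Bool → V) (U : V → Set (Set (E × Bool)))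
    (h : E × Bool → Bool) : Prop :=
  (∀ v, vertexwardsAt vend h v ∈ U v) ∧
  ∀ e, ¬(h (e, false) = true ∧ h (e, true) = true)

/-- An asynchronous GORP move: flip a single half-edge, landing in a valid state. -/
def AsyncStep {V E : Type*} (vend : E → Bool → V) (U : V → Set (Set (E × Bool)))
    (h h' : E × Bool → Bool) : Prop :=
  AsyncValid vend U h' ∧ ∃ x, h' x ≠ h x ∧ ∀ y, y ≠ x → h' y = h y

/-- The half-edge orientation induced by an orientation `o`: the half `(e, b)` points
vertexwards iff `e` is directed towards `vend e b`, i.e. `o e = b`. -/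
def indHalf {E : Type*} (o : E → Bool) : E × Bool → Bool := fun x => x.2 == o x.1

/-- A token GORP state (half-edge orientations plus token position) satisfies the
vertex constraints. -/
def TokenValid {V E : Type*} (vend : E → Bool → V) (U : V → Set (Set (E × Bool)))
    (q : (E × Bool → Bool) × Option E) : Prop :=
  ∀ v, vertexwardsAt vend q.1 v ∈ U v

/-- A token GORP move, landing in a state satisfying all vertex constraints; either:
flip a half-edge so that it points vertexwards; move the token to an edge at least one
of whose halves points edgewards; flip either half of the edge holding the token; or
remove the token from the graph. -/
def TokenMove {V E : Type*} (vend : E → Bool → V) (U : V → Set (Set (E × Bool)))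
    (q q' : (E × Bool → Bool) × Option E) : Prop :=
  TokenValid vend U q' ∧
  ((∃ x, q.1 x = false ∧ q'.1 x = true ∧ (∀ y, y ≠ x → q'.1 y = q.1 y) ∧ q'.2 = q.2) ∨
   (∃ e, (q.1 (e, false) = false ∨ q.1 (e, true) = false) ∧
      q'.1 = q.1 ∧ q'.2 = some e) ∨
   (∃ e b, q.2 = some e ∧ q'.1 (e, b) = !q.1 (e, b) ∧
      (∀ y, y ≠ (e, b) → q'.1 y = q.1 y) ∧ q'.2 = some e) ∨
   (q'.1 = q.1 ∧ q'.2 = none))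

section Reconfiguration

variable {V E : Type*} {vend : E → Bool → V} {U : V → Set (Set (E × Bool))}

/-- Every half-edge that is vertexwards in `h` is directed towards its vertex by `o`. -/
def Extends (o : E → Bool) (h : E × Bool → Bool) : Prop :=
  ∀ e b, h (e, b) = true → o e = b

theorem Extends.satOrient (hup : UpwardClosed vend U) {o : E → Bool} {h : E × Bool → Bool}
    (hv : ∀ v, vertexwardsAt vend h v ∈ U v) (ho : Extends o h) : SatOrient vend U o :=
  fun v => hup v _ (hv v) _ (fun x hx => ⟨hx.1, ho x.1 x.2 hx.2⟩) fun _ hx => hx.1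

theorem indHalf_eq_true {o : E → Bool} {e : E} {b : Bool} :
    indHalf o (e, b) = true ↔ o e = b := by
  simp only [indHalf, beq_iff_eq]
  exact eq_comm

theorem vertexwardsAt_indHalf (o : E → Bool) (v : V) :
    vertexwardsAt vend (indHalf o) v = incomingAt vend o v := by
  ext ⟨e, b⟩
  simp [vertexwardsAt, incomingAt, indHalf_eq_true]

theorem SatOrient.asyncValid {o : E → Bool} (h : SatOrient vend U o) :
    AsyncValid vend U (indHalf o) := by
  refine ⟨fun v => vertexwardsAt_indHalf (vend := vend) o v ▸ h v, fun e he => ?_⟩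
  simp [indHalf_eq_true] at he

open Classical in
theorem SyncStep.asyncReachable (noloop : ∀ e, vend e false ≠ vend e true)
    (hup : UpwardClosed vend U) {o o' : E → Bool} (ho : SatOrient vend U o)
    (hs : SyncStep vend U o o') :
    Relation.ReflTransGen (AsyncStep vend U) (indHalf o) (indHalf o') := by
  obtain ⟨ho', e, he, hne⟩ := hs
  have hloop : vend e (!o e) ≠ vend e (o e) := by
    cases o e
    · exact (noloop e).symm
    · exact noloop e
  have he' : o' e = !o e := by revert he; cases o e <;> cases o' e <;> simp
  have hmid : AsyncValid vend U (Function.update (indHalf o) (e, o e) false) := by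
    refine ⟨fun v => ?_, fun f hf => ?_⟩
    · by_cases hv : v = vend e (o e)
      · refine hup v _ (ho' v) _ ?_ fun x hx => hx.1
        rintro ⟨f, b⟩ ⟨h1, h2⟩
        refine ⟨h1, ?_⟩
        by_cases hf : f = e
        · subst hf
          dsimp only at h1 h2
          rw [← h2, he', hv] at h1
          exact absurd h1 hloop
        · have : (f, b) ≠ (e, o e) := fun h => hf (congrArg Prod.fst h)
          rw [Function.update_of_ne this, indHalf_eq_true, ← hne f hf]
          exact h2
      · refine hup v _ (ho v) _ ?_ fun x hx => hx.1
        rintro ⟨f, b⟩ ⟨h1, h2⟩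
        refine ⟨h1, ?_⟩
        have : (f, b) ≠ (e, o e) := by
          intro h
          obtain ⟨rfl, rfl⟩ := Prod.mk.inj h
          exact hv h1.symm
        rw [Function.update_of_ne this, indHalf_eq_true]
        exact h2
    · refine ho.asyncValid.2 f ⟨?_, ?_⟩
      · by_contra hc
        have := hf.1
        simp only [Function.update_apply] at this
        split_ifs at this
        exact hc this
      · by_contra hc
        have := hf.2
        simp only [Function.update_apply] at this
        split_ifs at this
        exact hc this
  refine .tail (.single ⟨hmid, (e, o e), ?_, fun y hy => Function.update_of_ne hy _ _⟩)
    ⟨ho'.asyncValid, (e, !o e), ?_, ?_⟩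
  · simp [indHalf]
  · simp [indHalf, he']
  · rintro ⟨f, b⟩ hy
    by_cases hf : f = e
    · subst hf
      have hb : b = o f := by
        by_contra hb
        exact hy (by rw [Bool.eq_not.mpr hb])
      subst hb
      simp [indHalf, he']
    · have : (f, b) ≠ (e, o e) := fun h => hf (congrArg Prod.fst h)
      rw [Function.update_of_ne this]
      simp [indHalf, hne f hf]

theorem asyncReachable_of_syncReachable (noloop : ∀ e, vend e false ≠ vend e true)
    (hup : UpwardClosed vend U) {I F : E → Bool} (hI : SatOrient vend U I)
    (h : Relation.ReflTransGen (SyncStep vend U) I F) :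
    Relation.ReflTransGen (AsyncStep vend U) (indHalf I) (indHalf F) := by
  induction h using Relation.ReflTransGen.head_induction_on with
  | refl => exact .refl
  | head hs _ ih => exact (hs.asyncReachable noloop hup hI).trans (ih hs.1)

theorem AsyncStep.tokenReachable {h h' : E × Bool → Bool} (hv : AsyncValid vend U h)
    (hs : AsyncStep vend U h h') :
    Relation.ReflTransGen (TokenMove vend U) (h, none) (h', none) := by
  obtain ⟨hv', ⟨e, b⟩, hx, hne⟩ := hs
  have hflip : h' (e, b) = !h (e, b) := Bool.eq_not.mpr hx
  cases hb : h (e, b) with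
  | false => exact .single ⟨hv'.1, .inl ⟨(e, b), hb, by simp [hflip, hb], hne, rfl⟩⟩
  | true =>
    have hfree : h (e, false) = false ∨ h (e, true) = false := by
      simp only [← Bool.not_eq_true]
      exact not_and_or.mp (hv.2 e)
    have place : TokenMove vend U (h, none) (h, some e) :=
      ⟨hv.1, .inr (.inl ⟨e, hfree, rfl, rfl⟩)⟩
    have flip : TokenMove vend U (h, some e) (h', some e) :=
      ⟨hv'.1, .inr (.inr (.inl ⟨e, b, rfl, hflip, hne, rfl⟩))⟩
    have remove : TokenMove vend U (h', some e) (h', none) :=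
      ⟨hv'.1, .inr (.inr (.inr ⟨rfl, rfl⟩))⟩
    exact ((Relation.ReflTransGen.single place).tail flip).tail remove

theorem tokenReachable_of_asyncReachable {h h' : E × Bool → Bool} (hv : AsyncValid vend U h)
    (hr : Relation.ReflTransGen (AsyncStep vend U) h h') :
    Relation.ReflTransGen (TokenMove vend U) (h, none) (h', none) := by
  induction hr using Relation.ReflTransGen.head_induction_on with
  | refl => exact .refl
  | head hs _ ih => exact (hs.tokenReachable hv).trans (ih hs.1)

/-- Every edge with both halves vertexwards holds the token. -/
def DoublesHoldToken (q : (E × Bool → Bool) × Option E) : Prop :=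
  ∀ e, (∀ b, q.1 (e, b) = true) → q.2 = some e

/-- A double edge without the token stays so under every token move. -/
theorem TokenMove.doublesHoldToken {q q' : (E × Bool → Bool) × Option E}
    (hs : TokenMove vend U q q') (hq' : DoublesHoldToken q') : DoublesHoldToken q := by
  intro e he
  by_contra hc
  obtain ⟨-, ⟨x, hx, hx', hne, ht⟩ | ⟨f, hf, hh, ht⟩ | ⟨f, b, htf, -, hne, ht⟩ | ⟨hh, ht⟩⟩ := hs
  · refine hc (ht ▸ hq' e fun b => ?_)
    by_cases hb : (e, b) = x
    · rw [hb, hx']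
    · rw [hne _ hb, he]
  · have := hq' e fun b => by rw [hh, he]
    rw [ht, Option.some.injEq] at this
    subst this
    simp [he] at hf
  · refine hc ?_
    rw [htf, ← ht]
    refine hq' e fun c => ?_
    rw [hne _ fun h => hc ?_, he]
    rw [htf, show e = f from congrArg Prod.fst h]
  · have := hq' e fun b => by rw [hh, he]
    simp [ht] at this

/-- `o` extends `h` away from double edges, and extends some valid state below `h`. -/
def Shadows (vend : E → Bool → V) (U : V → Set (Set (E × Bool))) (o : E → Bool)
    (h : E × Bool → Bool) : Prop :=
  (∃ k : E × Bool → Bool, (∀ v, vertexwardsAt vend k v ∈ U v) ∧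
    (∀ x, k x = true → h x = true) ∧ Extends o k) ∧
  ∀ e b, h (e, b) = true → h (e, !b) = false → o e = b

open Classical in
theorem syncReachable_update {o : E → Bool} {e : E} {b : Bool}
    (h : SatOrient vend U (Function.update o e b)) :
    Relation.ReflTransGen (SyncStep vend U) o (Function.update o e b) := by
  by_cases hb : b = o e
  · rw [hb, Function.update_eq_self]
  · exact .single ⟨h, e, by simpa using hb, fun f hf => Function.update_of_ne hf _ _⟩

open Classical in
/-- When only the edge `e` changes and no double edge results, `o` can follow. -/
theorem exists_shadows_of_no_double (hup : UpwardClosed vend U) {o : E → Bool}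
    {h' : E × Bool → Bool} (e : E) (hv : ∀ v, vertexwardsAt vend h' v ∈ U v)
    (hd : ∀ f, ¬ ∀ b, h' (f, b) = true)
    (ho : ∀ f b, f ≠ e → h' (f, b) = true → o f = b) :
    ∃ o', Relation.ReflTransGen (SyncStep vend U) o o' ∧ Shadows vend U o' h' := by
  obtain ⟨b, hb⟩ : ∃ b, h' (e, !b) = false := by
    by_contra! hc
    exact hd e fun b => by simpa using hc (!b)
  have hext : Extends (Function.update o e b) h' := by
    intro f c hc
    by_cases hf : f = e
    · subst hf
      rw [Function.update_self]
      by_contra hbc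
      rw [show c = !b from Bool.eq_not.mpr (Ne.symm hbc), hb] at hc
      cases hc
    · rw [Function.update_of_ne hf]
      exact ho f c hf hc
  exact ⟨_, syncReachable_update (hext.satOrient hup hv), ⟨h', hv, fun _ hx => hx, hext⟩,
    fun f c hc _ => hext f c hc⟩

open Classical in
/-- Turning one half-edge vertexwards can be followed by a shadowing orientation. -/
theorem exists_shadows_of_gain (hup : UpwardClosed vend U)
    {q q' : (E × Bool → Bool) × Option E} {o : E → Bool} {e : E} {b : Bool}
    (hv : TokenValid vend U q') (hq' : DoublesHoldToken q')
    (hx' : q'.1 (e, b) = true)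
    (hne : ∀ y, y ≠ (e, b) → q'.1 y = q.1 y) (ho : Shadows vend U o q.1) :
    ∃ o', Relation.ReflTransGen (SyncStep vend U) o o' ∧ Shadows vend U o' q'.1 := by
  have hoff : ∀ f c, f ≠ e → q'.1 (f, c) = q.1 (f, c) := fun f c hf =>
    hne _ fun h => hf (congrArg Prod.fst h)
  obtain ⟨⟨k, hk, hkq, hok⟩, ho⟩ := ho
  have hkq' : ∀ x, k x = true → q'.1 x = true := by
    intro x hxk
    by_cases h : x = (e, b)
    · rw [h, hx']
    · rw [hne x h, hkq x hxk]
  by_cases hd : ∃ f, ∀ c, q'.1 (f, c) = true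
  · obtain ⟨f, hf⟩ := hd
    by_cases hfe : f = e
    · subst hfe
      refine ⟨o, .refl, ⟨k, hk, hkq', hok⟩, fun g c hc hc' => ?_⟩
      by_cases hg : g = f
      · subst hg
        rw [hf] at hc'
        cases hc'
      · rw [hoff g _ hg] at hc hc'
        exact ho g c hc hc'
    · have hb : q'.1 (e, !b) = false := by
        by_contra hc
        have he : ∀ c, q'.1 (e, c) = true := by
          intro c
          by_cases hcb : c = b
          · rw [hcb, hx']
          · rw [Bool.eq_not.mpr hcb]
            simpa using hc
        exact hfe (Option.some.inj ((hq' f hf).symm.trans (hq' e he)))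
      have key : ∀ c, q'.1 (e, c) = true → b = c := by
        intro c hc
        by_contra hbc
        rw [show c = !b from Bool.eq_not.mpr (Ne.symm hbc), hb] at hc
        cases hc
      have hext : Extends (Function.update o e b) k := by
        intro g c hc
        by_cases hg : g = e
        · subst hg
          rw [Function.update_self]
          exact key c (hkq' _ hc)
        · rw [Function.update_of_ne hg]
          exact hok g c hc
      refine ⟨_, syncReachable_update (hext.satOrient hup hk), ⟨k, hk, hkq', hext⟩,
        fun g c hc hc' => ?_⟩
      by_cases hg : g = e
      · subst hg
        rw [Function.update_self]
        exact key c hc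
      · rw [Function.update_of_ne hg]
        rw [hoff g _ hg] at hc hc'
        exact ho g c hc hc'
  · push Not at hd
    refine exists_shadows_of_no_double hup e hv (fun f hf => ?_) fun f c hf hc => ?_
    · obtain ⟨c, hc⟩ := hd f
      exact hc (hf c)
    · have hc' : q'.1 (f, !c) = false := by
        by_contra h
        obtain ⟨d, hd⟩ := hd f
        by_cases hdc : d = c
        · exact hd (hdc ▸ hc)
        · rw [Bool.eq_not.mpr hdc] at hd
          exact h (by simpa using hd)
      rw [hoff f _ hf] at hc hc'
      exact ho f c hc hc'

theorem TokenMove.exists_shadows (hup : UpwardClosed vend U)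
    {q q' : (E × Bool → Bool) × Option E} (hs : TokenMove vend U q q')
    (hq' : DoublesHoldToken q') {o : E → Bool} (ho : Shadows vend U o q.1) :
    ∃ o', Relation.ReflTransGen (SyncStep vend U) o o' ∧ Shadows vend U o' q'.1 := by
  have hq := hs.doublesHoldToken hq'
  obtain ⟨hv, ⟨⟨e, b⟩, -, hx', hne, -⟩ | ⟨-, -, hh, -⟩ | ⟨e, b, ht, hx, hne, ht'⟩ |
    ⟨hh, -⟩⟩ := hs
  · exact exists_shadows_of_gain hup hv hq' hx' hne ho
  · exact ⟨o, .refl, hh ▸ ho⟩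
  · cases hb : q.1 (e, b) with
    | false => exact exists_shadows_of_gain hup hv hq' (by simp [hx, hb]) hne ho
    | true =>
      refine exists_shadows_of_no_double hup e hv (fun f hf => ?_) fun f c hf hc => ?_
      · have := hq' f hf
        rw [ht', Option.some.injEq] at this
        subst this
        have := hf b
        simp [hx, hb] at this
      · rw [hne _ fun h => hf (congrArg Prod.fst h)] at hc
        refine ho.2 f c hc ?_
        by_contra h
        have := hq f fun d => by
          by_cases hdc : d = c
          · rw [hdc, hc]
          · rw [Bool.eq_not.mpr hdc]
            simpa using h
        rw [ht, Option.some.injEq] at this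
        exact hf this.symm
  · exact ⟨o, .refl, hh ▸ ho⟩

theorem syncReachable_of_tokenReachable (hup : UpwardClosed vend U) {I F : E → Bool}
    (hI : SatOrient vend U I)
    (h : Relation.ReflTransGen (TokenMove vend U) (indHalf I, none) (indHalf F, none)) :
    Relation.ReflTransGen (SyncStep vend U) I F := by
  have key : ∀ q, Relation.ReflTransGen (TokenMove vend U) q (indHalf F, none) →
      DoublesHoldToken q ∧
        ∀ o, Shadows vend U o q.1 → Relation.ReflTransGen (SyncStep vend U) o F := by
    intro q hq
    induction hq using Relation.ReflTransGen.head_induction_on with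
    | refl =>
      refine ⟨fun e he => ?_, fun o ho => ?_⟩
      · have := he (!F e)
        simp [indHalf] at this
      · have : o = F := funext fun e => ho.2 e (F e) (by simp [indHalf]) (by simp [indHalf])
        rw [this]
    | head hs _ ih =>
      refine ⟨hs.doublesHoldToken ih.1, fun o ho => ?_⟩
      obtain ⟨o', hoo', ho'⟩ := hs.exists_shadows hup ih.1 ho
      exact hoo'.trans (ih.2 o' ho')
  exact (key _ h).2 I ⟨⟨indHalf I, hI.asyncValid.1, fun _ hx => hx,
    fun _ _ => indHalf_eq_true.mp⟩, fun _ _ hb _ => indHalf_eq_true.mp hb⟩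

end Reconfiguration

/-- For a finite multigraph without self-loops with upward-closed
vertex types and orientations `I`, `F` both satisfying every vertex, the following are
equivalent: `I` reconfigures to `F` by synchronous GORP moves; the induced half-edge
orientations reconfigure by asynchronous GORP moves; and they reconfigure by token GORP
moves with the token absent initially and finally. -/
theorem gorp_variants_equiv {V E : Type*} [Fintype V] [Fintype E]
    (vend : E → Bool → V) (noloop : ∀ e, vend e false ≠ vend e true)
    (U : V → Set (Set (E × Bool)))
    (hloc : TypesLocal vend U) (hup : UpwardClosed vend U)
    (I F : E → Bool) (hI : SatOrient vend U I) (hF : SatOrient vend U F) :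
    (Relation.ReflTransGen (SyncStep vend U) I F ↔
      Relation.ReflTransGen (AsyncStep vend U) (indHalf I) (indHalf F)) ∧
    (Relation.ReflTransGen (AsyncStep vend U) (indHalf I) (indHalf F) ↔
      Relation.ReflTransGen (TokenMove vend U) (indHalf I, none) (indHalf F, none)) := by
  have sync_async := asyncReachable_of_syncReachable (F := F) noloop hup hI
  have async_token := tokenReachable_of_asyncReachable (h' := indHalf F) hI.asyncValid
  have token_sync := syncReachable_of_tokenReachable (F := F) hup hI
  exact ⟨⟨sync_async, token_sync ∘ async_token⟩, ⟨async_token, sync_async ∘ token_sync⟩⟩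
end

section
/- Let a GORP instance with upward-closed vertex types be given, with satisfying orientations I and F, and consider any sequence of token GORP moves that reconfigures the half-edge orientations induced by I to those induced by F, with the token absent in both the initial and final states. Then at every intermediate state of this sequence, if both halves of an edge e point vertexwards, the token is located at e. -/
/-- An edge with both halves vertexwards that does not hold the token keeps this property
under every token move: the token cannot move onto it. -/
theorem TokenMove.both_vertexwards_of_token_ne {V E : Type*} {vend : E → Bool → V}
    {U : V → Set (Set (E × Bool))} {q q' : (E × Bool → Bool) × Option E}
    (h : TokenMove vend U q q') {e : E} (he : ∀ b, q.1 (e, b) = true)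
    (ht : q.2 ≠ some e) : (∀ b, q'.1 (e, b) = true) ∧ q'.2 ≠ some e := by
  obtain ⟨-, ⟨x, -, hx, hy, ht'⟩ | ⟨e', he', hq, ht'⟩ | ⟨e', b', hte', -, hy, ht'⟩ |
    ⟨hq, ht'⟩⟩ := h
  · refine ⟨fun b => ?_, ht' ▸ ht⟩
    by_cases hxb : (e, b) = x
    · rw [hxb, hx]
    · rw [hy _ hxb, he]
  · refine ⟨fun b => hq ▸ he b, ?_⟩
    rw [ht']
    rintro ⟨⟩
    simp [he] at he'
  · have hne : e ≠ e' := by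
      rintro rfl
      exact ht hte'
    refine ⟨fun b => ?_, by rwa [ht', ← hte']⟩
    rw [hy _ (by simp [hne]), he]
  · exact ⟨fun b => hq ▸ he b, by simp [ht']⟩

/-- In any sequence of token GORP moves reconfiguring the half-edge
orientations induced by `I` to those induced by `F` (token absent initially and
finally), at every intermediate state, if both halves of an edge `e` point vertexwards
then the token is located at `e`. -/
theorem token_both_vertexwards_imp_token_there {V E : Type*} [Fintype V] [Fintype E]
    (vend : E → Bool → V) (noloop : ∀ e, vend e false ≠ vend e true)
    (U : V → Set (Set (E × Bool)))
    (hloc : TypesLocal vend U) (hup : UpwardClosed vend U)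
    (I F : E → Bool) (hI : SatOrient vend U I) (hF : SatOrient vend U F)
    (k : ℕ) (Q : ℕ → (E × Bool → Bool) × Option E)
    (h0 : Q 0 = (indHalf I, none)) (hk : Q k = (indHalf F, none))
    (hstep : ∀ j < k, TokenMove vend U (Q j) (Q (j + 1))) :
    ∀ j ≤ k, ∀ e : E, (Q j).1 (e, false) = true → (Q j).1 (e, true) = true →
      (Q j).2 = some e := by
  intro j hj e hf ht
  by_contra hne
  have key : ∀ m, j ≤ m → m ≤ k →
      (∀ b, (Q m).1 (e, b) = true) ∧ (Q m).2 ≠ some e := by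
    intro m hjm
    induction m, hjm using Nat.le_induction with
    | base => exact fun _ => ⟨Bool.forall_bool.2 ⟨hf, ht⟩, hne⟩
    | succ m _ ih =>
      intro hmk
      obtain ⟨h1, h2⟩ := ih (by omega)
      exact (hstep m (by omega)).both_vertexwards_of_token_ne h1 h2
  have h := (key k hj le_rfl).1 (!F e)
  simp [hk, indHalf] at h
end

section
/- Let G be a GORP instance with only upward-closed vertex types, with satisfying initial and target orientations I and F, and let e be an edge of G joining vertices u and v. Let G' be the instance obtained from G by replacing e with a new wire vertex w (of type U_wire = {{a},{b},{a,b}} on locations a, b) and two edges {u,w} and {w,v}, with the u-side edge labeled a and the v-side edge labeled b at w, and let I', F' be the orientations of G' induced from I, F by directing the two new edges consistently with the direction of e (e.g., if e points towards v then {u,w} points towards w and {w,v} points towards v). Then I' can be reconfigured to F' by synchronous GORP moves in G' if and only if I can be reconfigured to F by synchronous GORP moves in G. -/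
section Wire

variable {V E : Type*} [DecidableEq E]

/-- The incidence map of the subdivided graph: the edge `e₀` is replaced by a new wire
vertex `w = Sum.inr ()` and two edges `Sum.inr c` (for `c : Bool`), where `Sum.inr c`
joins the old endpoint `vend e₀ c` (its side `false`) to `w` (its side `true`); all
other edges are unchanged. -/
def vendSub (vend : E → Bool → V) (e₀ : E) :
    ({e : E // e ≠ e₀} ⊕ Bool) → Bool → (V ⊕ Unit)
  | Sum.inl e, b => Sum.inl (vend e.val b)
  | Sum.inr c, b => if b then Sum.inr () else Sum.inl (vend e₀ c)

/-- The relabeling of half-edges: the end of `e₀` at `vend e₀ b` becomes the end of the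
new edge `Sum.inr b` at the old vertex; all other half-edges are unchanged. -/
def psiHalf (e₀ : E) (x : E × Bool) : ({e : E // e ≠ e₀} ⊕ Bool) × Bool :=
  if h : x.1 = e₀ then (Sum.inr x.2, false) else (Sum.inl ⟨x.1, h⟩, x.2)

/-- The vertex types of the subdivided graph: old vertices keep their types
(transported along `psiHalf`), and the new wire vertex `w` gets the wire type
`{{a}, {b}, {a, b}}` on its two half-edges `a = (Sum.inr false, true)` (the end at `w`
of the `u`-side edge) and `b = (Sum.inr true, true)` (the end at `w` of the `v`-side
edge). -/
def USub (U : V → Set (Set (E × Bool))) (e₀ : E) :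
    (V ⊕ Unit) → Set (Set (({e : E // e ≠ e₀} ⊕ Bool) × Bool))
  | Sum.inl v => {S' | ∃ S ∈ U v, S' = psiHalf e₀ '' S}
  | Sum.inr _ =>
      { {((Sum.inr false : {e : E // e ≠ e₀} ⊕ Bool), true)},
        {((Sum.inr true : {e : E // e ≠ e₀} ⊕ Bool), true)},
        {((Sum.inr false : {e : E // e ≠ e₀} ⊕ Bool), true),
         ((Sum.inr true : {e : E // e ≠ e₀} ⊕ Bool), true)} }

/-- The orientation of the subdivided graph induced by an orientation `o` of the
original graph: old edges keep their orientation, and the two new edges are directed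
consistently with `e₀` (if `e₀` points towards `vend e₀ c`, then the edge on the
`vend e₀ c` side points towards `vend e₀ c` and the other new edge points towards
`w`). -/
def indSub (o : E → Bool) (e₀ : E) : ({e : E // e ≠ e₀} ⊕ Bool) → Bool
  | Sum.inl e => o e.val
  | Sum.inr c => c != o e₀

end Wire

section WireSubdivision

variable {V E : Type*} [DecidableEq E]

theorem psiHalf_self (e₀ : E) (b : Bool) : psiHalf e₀ (e₀, b) = (Sum.inr b, false) := by
  simp [psiHalf]

theorem psiHalf_of_ne (e₀ : E) (e : {e : E // e ≠ e₀}) (b : Bool) :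
    psiHalf e₀ (e.val, b) = (Sum.inl e, b) := by
  simp [psiHalf, e.2]

theorem psiHalf_injective (e₀ : E) : Function.Injective (psiHalf e₀) := by
  rintro ⟨e, b⟩ ⟨e', b'⟩ h
  unfold psiHalf at h
  grind

/-- The half-edges of an old vertex in the subdivided graph are the relabelings of its
half-edges in the original graph. -/
theorem incomingAt_sub_inl (vend : E → Bool → V) (e₀ : E)
    (p : ({e : E // e ≠ e₀} ⊕ Bool) → Bool) (v : V) :
    incomingAt (vendSub vend e₀) p (Sum.inl v) =
      psiHalf e₀ '' (psiHalf e₀ ⁻¹' incomingAt (vendSub vend e₀) p (Sum.inl v)) := by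
  refine (Set.image_preimage_eq_iff.2 ?_).symm
  rintro ⟨e | c, b⟩ h
  · exact ⟨(e.val, b), psiHalf_of_ne e₀ e b⟩
  · cases b
    · exact ⟨(e₀, c), psiHalf_self e₀ c⟩
    · simp [incomingAt, vendSub] at h

theorem incomingAt_sub_inl_mem_iff (vend : E → Bool → V) (U : V → Set (Set (E × Bool)))
    (e₀ : E) (p : ({e : E // e ≠ e₀} ⊕ Bool) → Bool) (v : V) :
    incomingAt (vendSub vend e₀) p (Sum.inl v) ∈ USub U e₀ (Sum.inl v) ↔
      psiHalf e₀ ⁻¹' incomingAt (vendSub vend e₀) p (Sum.inl v) ∈ U v := by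
  constructor
  · rintro ⟨S, hS, h⟩
    rwa [h, Set.preimage_image_eq _ (psiHalf_injective e₀)]
  · exact fun h => ⟨_, h, incomingAt_sub_inl vend e₀ p v⟩

/-- The wire vertex is satisfied iff one of the two new edges points towards it. -/
theorem incomingAt_sub_inr_mem_iff (vend : E → Bool → V) (U : V → Set (Set (E × Bool)))
    (e₀ : E) (p : ({e : E // e ≠ e₀} ⊕ Bool) → Bool) (w : Unit) :
    incomingAt (vendSub vend e₀) p (Sum.inr w) ∈ USub U e₀ (Sum.inr w) ↔
      p (Sum.inr false) = true ∨ p (Sum.inr true) = true := by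
  have hmem : ∀ x, x ∈ incomingAt (vendSub vend e₀) p (Sum.inr w) ↔
      (x = (Sum.inr false, true) ∧ p (Sum.inr false) = true) ∨
      (x = (Sum.inr true, true) ∧ p (Sum.inr true) = true) := by
    rintro ⟨e | c, b⟩
    · simp [incomingAt, vendSub]
    · cases b <;> cases c <;> simp [incomingAt, vendSub]
  simp only [USub, Set.mem_insert_iff, Set.mem_singleton_iff, Set.ext_iff, hmem]
  cases p (Sum.inr false) <;> cases p (Sum.inr true) <;> simp

theorem satOrient_sub_iff (vend : E → Bool → V) (U : V → Set (Set (E × Bool)))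
    (e₀ : E) (p : ({e : E // e ≠ e₀} ⊕ Bool) → Bool) :
    SatOrient (vendSub vend e₀) (USub U e₀) p ↔
      (p (Sum.inr false) = true ∨ p (Sum.inr true) = true) ∧
      ∀ v, psiHalf e₀ ⁻¹' incomingAt (vendSub vend e₀) p (Sum.inl v) ∈ U v := by
  simp only [SatOrient, Sum.forall, incomingAt_sub_inl_mem_iff, incomingAt_sub_inr_mem_iff,
    forall_const, and_comm]

theorem mem_preimage_incomingAt_sub (vend : E → Bool → V) (e₀ : E)
    (p : ({e : E // e ≠ e₀} ⊕ Bool) → Bool) (v : V) (x : E × Bool) :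
    x ∈ psiHalf e₀ ⁻¹' incomingAt (vendSub vend e₀) p (Sum.inl v) ↔
      vend x.1 x.2 = v ∧
        if h : x.1 = e₀ then p (Sum.inr x.2) = false else p (Sum.inl ⟨x.1, h⟩) = x.2 := by
  obtain ⟨e, b⟩ := x
  by_cases h : e = e₀
  · subst h
    simp [psiHalf, incomingAt, vendSub]
  · simp [psiHalf, incomingAt, vendSub, h]

theorem preimage_incomingAt_indSub (vend : E → Bool → V) (e₀ : E) (o : E → Bool) (v : V) :
    psiHalf e₀ ⁻¹' incomingAt (vendSub vend e₀) (indSub o e₀) (Sum.inl v) =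
      incomingAt vend o v := by
  ext ⟨e, b⟩
  rw [mem_preimage_incomingAt_sub]
  by_cases h : e = e₀
  · subst h
    cases b <;> simp [incomingAt, indSub]
  · simp [incomingAt, indSub, h]

theorem SatOrient.indSub {vend : E → Bool → V} {U : V → Set (Set (E × Bool))}
    {o : E → Bool} (ho : SatOrient vend U o) (e₀ : E) :
    SatOrient (vendSub vend e₀) (USub U e₀) (indSub o e₀) := by
  refine (satOrient_sub_iff vend U e₀ _).2 ⟨?_, fun v => ?_⟩
  · cases h : o e₀ <;> simp [_root_.indSub, h]
  · rw [preimage_incomingAt_indSub]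
    exact ho v

/-- Forget the wire vertex: `e₀` points towards its `true` end iff the new edge at that
end does.  In particular, if both new edges point towards the wire vertex, then `e₀`
points towards its `false` end. -/
def contractWire (e₀ : E) (p : ({e : E // e ≠ e₀} ⊕ Bool) → Bool) : E → Bool :=
  fun e => if h : e = e₀ then !p (Sum.inr true) else p (Sum.inl ⟨e, h⟩)

theorem contractWire_indSub (e₀ : E) (o : E → Bool) :
    contractWire e₀ (indSub o e₀) = o := by
  funext e
  by_cases h : e = e₀
  · subst h
    simp [contractWire, indSub]
  · simp [contractWire, indSub, h]

theorem SatOrient.contractWire {vend : E → Bool → V} {U : V → Set (Set (E × Bool))}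
    (hup : UpwardClosed vend U) {e₀ : E} {p : ({e : E // e ≠ e₀} ⊕ Bool) → Bool}
    (hp : SatOrient (vendSub vend e₀) (USub U e₀) p) :
    SatOrient vend U (contractWire e₀ p) := by
  obtain ⟨hw, hv⟩ := (satOrient_sub_iff vend U e₀ p).1 hp
  refine fun v => hup v _ (hv v) _ ?_ fun x hx => hx.1
  rintro ⟨e, b⟩ hx
  obtain ⟨hend, hdir⟩ := (mem_preimage_incomingAt_sub vend e₀ p v _).1 hx
  refine ⟨hend, ?_⟩
  by_cases h : e = e₀
  · cases b <;> simp_all [_root_.contractWire]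
  · simpa [_root_.contractWire, h] using hdir

theorem SyncStep.contractWire {vend : E → Bool → V} {U : V → Set (Set (E × Bool))}
    (hup : UpwardClosed vend U) {e₀ : E} {p q : ({e : E // e ≠ e₀} ⊕ Bool) → Bool}
    (h : SyncStep (vendSub vend e₀) (USub U e₀) p q) :
    Relation.ReflTransGen (SyncStep vend U) (contractWire e₀ p) (contractWire e₀ q) := by
  obtain ⟨hq, a, ha, hne⟩ := h
  by_cases heq : _root_.contractWire e₀ q = _root_.contractWire e₀ p
  · rw [heq]
  refine .single ⟨hq.contractWire hup, ?_⟩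
  obtain ⟨e, he⟩ := Function.ne_iff.1 heq
  refine ⟨e, he, fun e' he' => ?_⟩
  unfold _root_.contractWire at he ⊢
  grind

/-- Flipping `e₀` takes two moves in the subdivided graph, through the orientation in
which both new edges point towards the wire vertex. -/
theorem SyncStep.indSub {vend : E → Bool → V} (noloop : ∀ e, vend e false ≠ vend e true)
    {U : V → Set (Set (E × Bool))} {o o' : E → Bool} (ho : SatOrient vend U o)
    (h : SyncStep vend U o o') (e₀ : E) :
    Relation.ReflTransGen (SyncStep (vendSub vend e₀) (USub U e₀))
      (indSub o e₀) (indSub o' e₀) := by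
  obtain ⟨ho', e, he, hne⟩ := h
  by_cases hee : e = e₀
  · subst hee
    let m : ({e' : E // e' ≠ e} ⊕ Bool) → Bool := Sum.elim (fun e' => o e'.val) fun _ => true
    have hm : SatOrient (vendSub vend e) (USub U e) m := by
      refine (satOrient_sub_iff vend U e m).2 ⟨Or.inl rfl, fun v => ?_⟩
      have hnl := noloop e
      by_cases hv : vend e (o e) = v
      · convert ho' v using 1
        ext ⟨f, b⟩
        rw [mem_preimage_incomingAt_sub]
        by_cases hf : f = e
        · subst hf
          simp only [m, incomingAt, Set.mem_ofPred_eq]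
          cases h1 : o f <;> cases h2 : o' f <;> cases b <;> grind
        · simp [m, incomingAt, hf, hne]
      · convert ho v using 1
        ext ⟨f, b⟩
        rw [mem_preimage_incomingAt_sub]
        by_cases hf : f = e
        · subst hf
          simp only [m, incomingAt, Set.mem_ofPred_eq]
          cases h1 : o f <;> cases b <;> simp_all
        · simp [m, incomingAt, hf]
    refine .tail (.single (b := m) ⟨hm, Sum.inr (o e), ?_, ?_⟩)
      ⟨ho'.indSub e, Sum.inr (o' e), ?_, ?_⟩
    · simp [m, _root_.indSub]
    · rintro (f | c) hc
      · simp [m, _root_.indSub]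
      · simpa [m, _root_.indSub] using hc
    · simp [m, _root_.indSub]
    · rintro (f | c) hc
      · simp [m, _root_.indSub, hne f.val f.2]
      · simpa [m, _root_.indSub] using hc
  · refine .single ⟨ho'.indSub e₀, Sum.inl ⟨e, hee⟩, by simpa [_root_.indSub] using he, ?_⟩
    rintro (f | c) hc
    · exact hne f.val fun hf => hc (by simp [← hf])
    · simp [_root_.indSub, hne e₀ (Ne.symm hee)]

end WireSubdivision

/-- Subdividing an edge `e₀` with a wire vertex does not change
synchronous GORP reconfigurability: with all vertex types upward-closed and `I`, `F`
satisfying orientations, the induced orientations `I'`, `F'` of the subdivided instance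
reconfigure into each other by synchronous GORP moves iff `I` reconfigures to `F` by
synchronous GORP moves in the original instance. -/
theorem wire_subdivision_equiv {V E : Type*} [Fintype V] [Fintype E] [DecidableEq E]
    (vend : E → Bool → V) (noloop : ∀ e, vend e false ≠ vend e true)
    (U : V → Set (Set (E × Bool)))
    (hloc : TypesLocal vend U) (hup : UpwardClosed vend U)
    (e₀ : E) (I F : E → Bool) (hI : SatOrient vend U I) (hF : SatOrient vend U F) :
    Relation.ReflTransGen (SyncStep (vendSub vend e₀) (USub U e₀))
        (indSub I e₀) (indSub F e₀) ↔
      Relation.ReflTransGen (SyncStep vend U) I F := by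
  constructor
  · intro h
    have key := h.lift' (contractWire e₀) fun _ _ hs => SyncStep.contractWire hup hs
    rwa [Function.onFun, contractWire_indSub, contractWire_indSub] at key
  · intro h
    have key : SatOrient vend U F ∧
        Relation.ReflTransGen (SyncStep (vendSub vend e₀) (USub U e₀))
          (indSub I e₀) (indSub F e₀) := by
      clear hF
      induction h with
      | refl => exact ⟨hI, .refl⟩
      | tail _ hs ih => exact ⟨hs.1, ih.2.trans (hs.indSub noloop ih.1 e₀)⟩
    exact key.2
end

section
/- Let U be a GORP vertex type on location set L with initial state I ∈ U, and let G be a prefix-closed gizmo on L ⊔ {x}. For a traversal sequence X ∈ G, let R_X denote the set of locations closed for X. If R_X ∈ U for every traversal sequence X ∈ G, and R_∅ ⊆ I (where ∅ is the empty traversal sequence), then G is sound with respect to (U, I). -/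
/-- `ClosedFor G X a` : the location `a` is closed for the traversal sequence `X` in
`G`: any continuation `Y` after `X` that ends with a traversal `ℓ → a` exiting at `a`
(with `ℓ ≠ a`) must contain an earlier traversal `a → b` entering through `a`. -/
def ClosedFor {α : Type*} (G : Set (TravSeq α)) (X : TravSeq α) (a : α) : Prop :=
  ∀ (ℓ : α) (Y : TravSeq α), ℓ ≠ a → X ++ Y ++ [(ℓ, a)] ∈ G → ∃ b, (a, b) ∈ Y

/-- `GizmoSound G U I` : the gizmo `G` on `L ⊔ {x}` is sound with respect to the vertex
type `U` with initial state `I`: every traversal sequence `X ∈ G` admits a sequence of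
states `S 0, …, S (X.length)` with each `S i ∈ U`, `S 0 ⊆ I`, such that a traversal
exiting at a location `a ≠` its entrance requires `a ∉ S i`, and a location can leave
the state only via a traversal entering through it. -/
def GizmoSound {L : Type*} (G : Set (TravSeq (L ⊕ Unit))) (U : Set (Set L))
    (I : Set L) : Prop :=
  ∀ X ∈ G, ∃ S : ℕ → Set L,
    (∀ i ≤ X.length, S i ∈ U) ∧
    S 0 ⊆ I ∧
    (∀ (i : ℕ) (h : i < X.length) (a : L),
        (X.get ⟨i, h⟩).2 = Sum.inl a → (X.get ⟨i, h⟩).1 ≠ Sum.inl a → a ∉ S i) ∧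
    (∀ (i : ℕ) (h : i < X.length) (a : L),
        a ∈ S i → a ∉ S (i + 1) → (X.get ⟨i, h⟩).1 = Sum.inl a)

/-- Let `U` be a GORP vertex type on location set `L` with initial
state `I ∈ U`, and let `G` be a prefix-closed gizmo on `L ⊔ {x}`.  If the set `R_X` of
locations (in `L`) closed for `X` lies in `U` for every `X ∈ G`, and `R_∅ ⊆ I`, then
`G` is sound with respect to `(U, I)`. -/
theorem sound_of_closed_states {L : Type*} (G : Set (TravSeq (L ⊕ Unit)))
    (hG : IsGizmo G) (hpc : PrefixClosed G)
    (U : Set (Set L)) (I : Set L) (hI : I ∈ U)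
    (hR : ∀ X ∈ G, {a : L | ClosedFor G X (Sum.inl a)} ∈ U)
    (hR0 : {a : L | ClosedFor G ([] : TravSeq (L ⊕ Unit)) (Sum.inl a)} ⊆ I) :
    GizmoSound G U I := by
  have take_mem : ∀ X ∈ G, ∀ i, X.take i ∈ G := fun X hX i =>
    hpc (X.take i) (X.drop i) (by rwa [List.take_append_drop])
  intro X hX
  refine ⟨fun i => {a : L | ClosedFor G (X.take i) (Sum.inl a)},
    fun i _ => hR _ (take_mem X hX i), by simpa using hR0, ?_, ?_⟩
  · intro i h a h_exit h_ne h_closed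
    have h_mem : X.take i ++ [] ++ [((X.get ⟨i, h⟩).1, Sum.inl a)] ∈ G := by
      rw [← h_exit, List.append_nil]
      simpa using take_mem X hX (i + 1)
    obtain ⟨b, hb⟩ := h_closed _ [] h_ne h_mem
    exact List.not_mem_nil hb
  · intro i h a h_closed h_open
    simp only [Set.mem_ofPred_eq, ClosedFor, not_forall] at h_open
    obtain ⟨l, Y, h_ne, h_mem, hY⟩ := h_open
    obtain ⟨b, hb⟩ := h_closed l (X.get ⟨i, h⟩ :: Y) h_ne (by
      rw [← List.take_concat_get' X i h] at h_mem
      simpa only [List.append_assoc, List.singleton_append, List.cons_append, List.nil_append,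
        List.get_eq_getElem] using h_mem)
    rcases List.mem_cons.1 hb with hb | hb
    · rw [← hb]
    · exact (hY ⟨b, hb⟩).elim
end

section
/- In Push-1, blocks forming a 2×2 square are effectively fixed: if in a Push-1 configuration the four cells (i,j), (i+1,j), (i,j+1), (i+1,j+1) all contain blocks, then in every configuration reachable from it by a sequence of Push-1 moves, those same four cells still contain blocks. -/
/-- A cell `(x, y)` is within the `m × n` rectangular board. -/
def InBoard (m n : ℤ) (c : ℤ × ℤ) : Prop :=
  0 ≤ c.1 ∧ c.1 < m ∧ 0 ≤ c.2 ∧ c.2 < n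

/-- A Push-1 configuration on an `m × n` board: the player's cell and the set of cells
occupied by movable blocks, all within the board, with the player not on a block. -/
structure PushConfig (m n : ℤ) where
  player : ℤ × ℤ
  blocks : Set (ℤ × ℤ)
  player_in : InBoard m n player
  blocks_in : ∀ c ∈ blocks, InBoard m n c
  player_not_block : player ∉ blocks

/-- The four unit orthogonal directions. -/
def IsDir (d : ℤ × ℤ) : Prop :=
  d = (1, 0) ∨ d = (-1, 0) ∨ d = (0, 1) ∨ d = (0, -1)

/-- A Push-1 move: the player steps in a unit orthogonal direction `d` to the adjacent
cell `c` (within the board).  If `c` is empty, only the player moves; if `c` contains a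
block and the next cell `c + d` is within the board and empty, then the block is pushed
to `c + d` and the player moves to `c`; otherwise no move is possible. -/
def PushMove {m n : ℤ} (q q' : PushConfig m n) : Prop :=
  ∃ d : ℤ × ℤ, IsDir d ∧
    q'.player = q.player + d ∧ InBoard m n (q.player + d) ∧
    ((q.player + d ∉ q.blocks ∧ q'.blocks = q.blocks) ∨
     (q.player + d ∈ q.blocks ∧ InBoard m n (q.player + d + d) ∧
        q.player + d + d ∉ q.blocks ∧
        q'.blocks = insert (q.player + d + d) (q.blocks \ {q.player + d})))

/-- A block survives a move if along each axis it has a neighbouring block. -/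
theorem PushMove.mem_blocks {m n : ℤ} {q q' : PushConfig m n} (h : PushMove q q')
    {x : ℤ × ℤ} (hx : x ∈ q.blocks)
    (hnb : ∀ d, IsDir d → x - d ∈ q.blocks ∨ x + d ∈ q.blocks) : x ∈ q'.blocks := by
  obtain ⟨d, hd, -, -, ⟨-, hB⟩ | ⟨-, -, hfree, hB⟩⟩ := h
  · rwa [hB]
  · rw [hB]
    refine Set.mem_insert_of_mem _ ⟨hx, ?_⟩
    rintro rfl
    rcases hnb d hd with h | h
    · exact q.player_not_block (by simpa using h)
    · exact hfree h

/-- In Push-1, blocks forming a `2 × 2` square are effectively fixed: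
if the four cells `(i, j)`, `(i+1, j)`, `(i, j+1)`, `(i+1, j+1)` all contain blocks,
then in every configuration reachable by a sequence of Push-1 moves those same four
cells still contain blocks. -/
theorem push1_two_by_two_fixed {m n : ℤ} (q q' : PushConfig m n)
    (i j : ℤ)
    (h1 : (i, j) ∈ q.blocks) (h2 : (i + 1, j) ∈ q.blocks)
    (h3 : (i, j + 1) ∈ q.blocks) (h4 : (i + 1, j + 1) ∈ q.blocks)
    (hreach : Relation.ReflTransGen PushMove q q') :
    (i, j) ∈ q'.blocks ∧ (i + 1, j) ∈ q'.blocks ∧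
    (i, j + 1) ∈ q'.blocks ∧ (i + 1, j + 1) ∈ q'.blocks := by
  induction hreach with
  | refl => exact ⟨h1, h2, h3, h4⟩
  | tail _ hmove ih =>
    obtain ⟨h1, h2, h3, h4⟩ := ih
    refine ⟨hmove.mem_blocks h1 ?_, hmove.mem_blocks h2 ?_,
      hmove.mem_blocks h3 ?_, hmove.mem_blocks h4 ?_⟩ <;>
    · rintro d (rfl | rfl | rfl | rfl) <;> simp [*]
end
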